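/- arXiv:1309.5754 — 3 statements merged into one kernel-verified Lean document; each statement's English description precedes it below -/
import Mathlib

section
/- Let G be a finite group acting faithfully and transitively on a finite set X such that every non-identity element of G fixes at most one point of X. Suppose the set N consisting of the identity together with all elements of G fixing no point of X is a subgroup of G. Then for every x ∈ X, the subgroup N is a normal complement in G of the stabilizer of x: N is normal in G, N intersects the stabilizer trivially, and N times the stabilizer equals G. -/
open Pointwise

/-- `N` is a normal complement of `H` in `G`: `N` is normal, `N ∩ H = 1` and `NH = G`. -/
def IsNormalComplement {G : Type*} [Group G] (N H : Subgroup G) : Prop :=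
  N.Normal ∧ N ⊓ H = ⊥ ∧ (N : Set G) * (H : Set G) = Set.univ

/-- Frobenius: if a finite group `G` acts faithfully and transitively on a finite set `X`,
every non-identity element fixes at most one point, and the set consisting of the identity
together with the fixed-point-free elements is a subgroup `N`, then `N` is a normal
complement of every point stabilizer. -/
theorem frobenius_kernel_normal_complement_of_complement
    (G X : Type*) [Group G] [Finite G] [Finite X] [MulAction G X]
    [FaithfulSMul G X] [MulAction.IsPretransitive G X]
    (hfix : ∀ g : G, g ≠ 1 → ∀ x y : X, g • x = x → g • y = y → x = y)
    (N : Subgroup G) (hN : (N : Set G) = {g : G | g = 1 ∨ ∀ x : X, g • x ≠ x}) :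
    ∀ x : X, IsNormalComplement N (MulAction.stabilizer G x) := by
  classical
  intro x
  have hmem : ∀ g : G, g ∈ N ↔ (g = 1 ∨ ∀ x : X, g • x ≠ x) := by
    intro g
    rw [← SetLike.mem_coe, hN]
    rfl
  have hfree : ∀ g ∈ N, ∀ y : X, g • y = y → g = 1 := by
    intro g hg y hy
    rcases (hmem g).1 hg with h | h
    · exact h
    · exact absurd hy (h y)
  refine ⟨⟨?_⟩, ?_, ?_⟩
  · intro n hn g
    rcases (hmem n).1 hn with h | h
    · subst h
      simp
    · refine (hmem _).2 (Or.inr fun y hy => h (g⁻¹ • y) ?_)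
      rw [mul_smul, mul_smul] at hy
      rw [eq_inv_smul_iff]
      exact hy
  · rw [eq_bot_iff]
    rintro g ⟨hg, hgx⟩
    exact hfree g hg x hgx
  · cases nonempty_fintype G
    cases nonempty_fintype X
    have hB := MulAction.sum_card_fixedBy_eq_card_orbits_mul_card_group G X
    have horb : Fintype.card (Quotient (MulAction.orbitRel G X)) = 1 := by
      rw [Fintype.card_eq_one_iff]
      refine ⟨Quotient.mk _ x, fun q => ?_⟩
      induction q using Quotient.inductionOn with
      | h y => exact Quotient.sound (MulAction.exists_smul_eq G x y)
    rw [horb, one_mul] at hB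
    have hpt : ∀ g : G, Fintype.card (MulAction.fixedBy X g) + (if g ∈ N then 1 else 0)
        = 1 + (if g = 1 then Fintype.card X else 0) := by
      intro g
      by_cases h1 : g = 1
      · subst h1
        have : Fintype.card (MulAction.fixedBy X (1 : G)) = Fintype.card X :=
          Fintype.card_congr ((Equiv.setCongr (by simp)).trans (Equiv.Set.univ X))
        rw [this]
        simp [N.one_mem, add_comm]
      · by_cases hg : g ∈ N
        · have : Fintype.card (MulAction.fixedBy X g) = 0 := by
            rw [Fintype.card_eq_zero_iff]
            exact ⟨fun y => h1 (hfree g hg y.1 y.2)⟩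
          simp [this, h1, hg]
        · have : Fintype.card (MulAction.fixedBy X g) = 1 := by
            by_cases h3 : ∃ y : X, g • y = y
            · obtain ⟨y, hy⟩ := h3
              rw [Fintype.card_eq_one_iff]
              exact ⟨⟨y, hy⟩, fun z => Subtype.ext (hfix g h1 z.1 y z.2 hy)⟩
            · exact absurd ((hmem g).2 (Or.inr fun y hy => h3 ⟨y, hy⟩)) hg
          simp [this, h1, hg]
    have hsum := Finset.sum_congr (rfl : (Finset.univ : Finset G) = Finset.univ)
      (fun g _ => hpt g)
    rw [Finset.sum_add_distrib, Finset.sum_add_distrib, hB] at hsum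
    have hcard : Fintype.card N = Fintype.card X := by
      have e : Fintype.card N = ∑ g : G, if g ∈ N then 1 else 0 := by
        rw [Finset.sum_boole, Fintype.card_subtype]
        rfl
      rw [e]
      simpa using hsum
    have hinj : Function.Injective (fun n : N => (n : G) • x) := by
      intro a b hab
      have hab' : (a : G) • x = (b : G) • x := hab
      have := hfree ((b : G)⁻¹ * a) (N.mul_mem (N.inv_mem b.2) a.2) x
        (by rw [mul_smul, hab', inv_smul_smul])
      exact Subtype.ext (inv_mul_eq_one.1 this).symm
    have hsurj := ((Fintype.bijective_iff_injective_and_card _).2 ⟨hinj, hcard⟩).2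
    rw [Set.eq_univ_iff_forall]
    intro g
    obtain ⟨n, hn⟩ := hsurj (g • x)
    have hn' : (n : G) • x = g • x := hn
    refine Set.mem_mul.2 ⟨n, n.2, (n : G)⁻¹ * g, ?_, by simp⟩
    rw [SetLike.mem_coe, MulAction.mem_stabilizer_iff, mul_smul, ← hn', inv_smul_smul]
end

section
/- Let G be the Frobenius group F_5 of order 20, realized as the semidirect product (ℤ/5ℤ) ⋊ (ℤ/5ℤ)ˣ where the unit group acts by multiplication (equivalently, G is the holomorph of the cyclic group of order 5). Then no subgroup of order 2 of G has a normal complement in G. -/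
open Pointwise

/-- The action of the units of `ℤ/5ℤ` on the (multiplicatively written) group `ℤ/5ℤ`
by multiplication, as a map to automorphisms. -/
def unitsAction : (ZMod 5)ˣ →* MulAut (Multiplicative (ZMod 5)) where
  toFun u := AddEquiv.toMultiplicative (AddAut.mulLeft u)
  map_one' := by ext x; simp [AddAut.mulLeft]
  map_mul' u v := by ext x; simp [AddAut.mulLeft, mul_smul]

/-- The Frobenius group `F₅` of order 20: the semidirect product
`(ℤ/5ℤ) ⋊ (ℤ/5ℤ)ˣ` with the units acting by multiplication. -/
abbrev F5 := SemidirectProduct (Multiplicative (ZMod 5)) (ZMod 5)ˣ unitsAction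

theorem F5_inv_sq (h : F5) (hh : h * h = 1) : ∃ g : F5, g * g = h := by
  obtain ⟨a, u⟩ := h
  have key : ∀ (a : Multiplicative (ZMod 5)) (u : (ZMod 5)ˣ),
      a * unitsAction u a = 1 → u * u = 1 →
      ∃ (b : Multiplicative (ZMod 5)) (v : (ZMod 5)ˣ), b * unitsAction v b = a ∧ v * v = u := by
    decide
  have h1 := congrArg SemidirectProduct.left hh
  have h2 := congrArg SemidirectProduct.right hh
  obtain ⟨b, v, hb, hv⟩ := key a u h1 h2
  exact ⟨⟨b, v⟩, SemidirectProduct.ext hb hv⟩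

/-- No subgroup of order 2 of the Frobenius group `F₅` of order 20 has a normal
complement. -/
theorem F5_order_two_no_normal_complement
    (H : Subgroup F5) (hH : Nat.card H = 2) :
    ¬ ∃ N : Subgroup F5, IsNormalComplement N H := by
  rintro ⟨N, hN, hbot, huniv⟩
  have hsq : ∀ x ∈ H, x * x = 1 := by
    intro x hx
    have h := pow_card_eq_one' (x := (⟨x, hx⟩ : H))
    rw [hH, pow_two] at h
    exact congrArg Subtype.val h
  have hHN : H = ⊥ := by
    rw [eq_bot_iff, ← hbot]
    intro x hx
    refine ⟨?_, hx⟩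
    obtain ⟨g, rfl⟩ := F5_inv_sq x (hsq x hx)
    have hg : g ∈ (N : Set F5) * (H : Set F5) := by rw [huniv]; trivial
    obtain ⟨n, hn, k, hk, rfl⟩ := Set.mem_mul.1 hg
    have hkk : k⁻¹ = k := inv_eq_of_mul_eq_one_left (hsq k hk)
    have h3 := N.mul_mem hn (hN.conj_mem n hn k)
    rw [hkk] at h3
    simpa [mul_assoc] using h3
  rw [hHN] at hH
  simp at hH
end

section
/- Let G = S_3 × S_3 and let G' be a subgroup of G of order 6 that is core-free in G (i.e., G' contains no nontrivial normal subgroup of G). Then both S_3 × {1} and {1} × S_3 are normal complements of G' in G. -/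
open Pointwise

abbrev P3 := Equiv.Perm (Fin 3)

lemma aux_conj : ∀ a : P3, a ^ 3 = 1 → ∀ g : P3, g * a * g⁻¹ = a ∨ g * a * g⁻¹ = a ^ 2 := by decide

lemma aux_el : ∀ a : P3, a ^ 3 = 1 ∨ a ^ 2 = 1 := by decide

set_option maxRecDepth 10000 in
lemma aux_comm : ∀ a p : P3, a ^ 2 = 1 → p ^ 3 = 1 →
    (a * p * a⁻¹ * p⁻¹) ^ 3 = 1 ∧ (a * p * a⁻¹ * p⁻¹ = 1 → a = 1 ∨ p = 1) := by decide

lemma aux_mem (H : Subgroup (P3 × P3))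
    (hcf : ∀ K : Subgroup (P3 × P3), K.Normal → K ≤ H → K = ⊥)
    (x : P3 × P3) (hx : x ∈ H) (h : ∀ g, g * x * g⁻¹ = x ∨ g * x * g⁻¹ = x ^ 2) : x = 1 := by
  have h1 := hcf (Subgroup.normalClosure {x}) inferInstance (by
    refine (Subgroup.closure_le _).2 ?_
    intro y hy
    obtain ⟨z, hz, hc⟩ := Group.mem_conjugatesOfSet_iff.1 hy
    rw [Set.mem_singleton_iff] at hz
    subst hz
    obtain ⟨g, rfl⟩ := isConj_iff.1 hc
    rcases h g with e | e <;> rw [e]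
    · exact hx
    · exact H.pow_mem hx 2)
  have h2 : x ∈ Subgroup.normalClosure {x} := Subgroup.subset_normalClosure rfl
  rw [h1] at h2
  exact h2

lemma aux_left (H : Subgroup (P3 × P3))
    (hcf : ∀ K : Subgroup (P3 × P3), K.Normal → K ≤ H → K = ⊥)
    (a : P3) (ha : a ^ 3 = 1) (hx : (a, 1) ∈ H) : a = 1 := by
  have := aux_mem H hcf _ hx (fun g => by
    rcases aux_conj a ha g.1 with e | e
    · left; ext1 <;> simp [e]
    · right; ext1 <;> simp [e])
  exact congrArg Prod.fst this

lemma aux_right (H : Subgroup (P3 × P3))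
    (hcf : ∀ K : Subgroup (P3 × P3), K.Normal → K ≤ H → K = ⊥)
    (a : P3) (ha : a ^ 3 = 1) (hx : (1, a) ∈ H) : a = 1 := by
  have := aux_mem H hcf _ hx (fun g => by
    rcases aux_conj a ha g.2 with e | e
    · left; ext1 <;> simp [e]
    · right; ext1 <;> simp [e])
  exact congrArg Prod.snd this

lemma aux_compl (N H : Subgroup (P3 × P3)) (hn : N.Normal) (hN : Nat.card N = 6)
    (hH : Nat.card H = 6) (h : N ⊓ H = ⊥) : IsNormalComplement N H := by
  refine ⟨hn, h, ?_⟩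
  refine (Subgroup.isComplement'_of_card_mul_and_disjoint ?_ (disjoint_iff.2 h)).mul_eq
  rw [hN, hH, Nat.card_prod, Nat.card_perm]
  simp [Nat.factorial]

/-- In `G = S₃ × S₃`, every core-free subgroup `G'` of order 6 has both `S₃ × {1}` and
`{1} × S₃` as normal complements. -/
theorem S3_prod_S3_coreFree_order_six_normal_complements
    (G' : Subgroup (Equiv.Perm (Fin 3) × Equiv.Perm (Fin 3)))
    (hcard : Nat.card G' = 6)
    (hcf : ∀ K : Subgroup (Equiv.Perm (Fin 3) × Equiv.Perm (Fin 3)),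
      K.Normal → K ≤ G' → K = ⊥) :
    IsNormalComplement ((⊤ : Subgroup (Equiv.Perm (Fin 3))).prod
        (⊥ : Subgroup (Equiv.Perm (Fin 3)))) G' ∧
    IsNormalComplement ((⊥ : Subgroup (Equiv.Perm (Fin 3))).prod
        (⊤ : Subgroup (Equiv.Perm (Fin 3)))) G' := by
  have hc6 : Nat.card P3 = 6 := by rw [Nat.card_perm]; simp [Nat.factorial]
  have : Fact (Nat.Prime 3) := ⟨Nat.prime_three⟩
  obtain ⟨⟨⟨p, q⟩, hx⟩, ho⟩ := exists_prime_orderOf_dvd_card' (G := G') 3 (by rw [hcard]; norm_num)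
  rw [← Subgroup.orderOf_coe] at ho
  have hpq : ((p, q) : P3 × P3) ^ 3 = 1 := orderOf_dvd_iff_pow_eq_one.1 (dvd_of_eq ho)
  have hp : p ^ 3 = 1 := congrArg Prod.fst hpq
  have hq : q ^ 3 = 1 := congrArg Prod.snd hpq
  have hne : ¬ (p = 1 ∧ q = 1) := by
    rintro ⟨rfl, rfl⟩
    have : orderOf (1 : P3 × P3) = 3 := ho
    simp at this
  have hp1 : p ≠ 1 := by
    rintro rfl
    exact hne ⟨rfl, aux_right G' hcf q hq hx⟩
  have hq1 : q ≠ 1 := by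
    rintro rfl
    exact hne ⟨aux_left G' hcf p hp hx, rfl⟩
  constructor
  · refine aux_compl _ _ inferInstance ?_ hcard ?_
    · rw [Nat.card_congr (Subgroup.prodEquiv _ _).toEquiv, Nat.card_prod]
      simp only [Subgroup.card_top, Subgroup.card_bot, hc6]
    · rw [eq_bot_iff]
      rintro ⟨a, b⟩ ⟨h1, h2⟩
      obtain rfl : b = 1 := h1.2
      have : a = 1 := by
        rcases aux_el a with h | h
        · exact aux_left G' hcf a h h2
        · have hm := G'.mul_mem (G'.mul_mem (G'.mul_mem h2 hx) (G'.inv_mem h2)) (G'.inv_mem hx)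
          obtain ⟨c1, c2⟩ := aux_comm a p h hp
          exact (c2 (aux_left G' hcf _ c1 (by simpa using hm))).resolve_right hp1
      subst this
      exact Subgroup.one_mem _
  · refine aux_compl _ _ inferInstance ?_ hcard ?_
    · rw [Nat.card_congr (Subgroup.prodEquiv _ _).toEquiv, Nat.card_prod]
      simp only [Subgroup.card_top, Subgroup.card_bot, hc6]
    · rw [eq_bot_iff]
      rintro ⟨b, a⟩ ⟨h1, h2⟩
      obtain rfl : b = 1 := h1.1
      have : a = 1 := by
        rcases aux_el a with h | h
        · exact aux_right G' hcf a h h2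
        · have hm := G'.mul_mem (G'.mul_mem (G'.mul_mem h2 hx) (G'.inv_mem h2)) (G'.inv_mem hx)
          obtain ⟨c1, c2⟩ := aux_comm a q h hq
          exact (c2 (aux_right G' hcf _ c1 (by simpa using hm))).resolve_right hq1
      subst this
      exact Subgroup.one_mem _
end
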